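/- arXiv:2304.00360 — 2 statements merged into one kernel-verified Lean document; each statement's English description precedes it below -/
import Mathlib

section
/- The integral ∫_0^1 √(1−x²) ln(x) / (2−x²)^{3/2} dx equals Γ(1/4)^2 (4 − 2π + 2 ln 2)/(64√(2π)) − π^{3/2}(π + ln 2)/(4√2 · Γ(1/4)^2). -/
open Real
open MeasureTheory Set

namespace S18

lemma beta_cpow_eq {a b t : ℝ} (ht : t ∈ Ioo (0:ℝ) 1) :
    (t : ℂ) ^ ((a : ℂ) - 1) * (1 - (t : ℂ)) ^ ((b : ℂ) - 1)
      = ((t ^ (a - 1) * (1 - t) ^ (b - 1) : ℝ) : ℂ) := by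
  have h1 : (0:ℝ) ≤ 1 - t := by linarith [ht.2]
  rw [Complex.ofReal_mul, Complex.ofReal_cpow ht.1.le, Complex.ofReal_cpow h1]
  push_cast
  rfl

lemma beta_integrable {a b : ℝ} (ha : 0 < a) (hb : 0 < b) :
    IntegrableOn (fun t : ℝ => t ^ (a - 1) * (1 - t) ^ (b - 1)) (Ioo 0 1) := by
  have h := Complex.betaIntegral_convergent (u := (a:ℂ)) (v := (b:ℂ)) (by simpa) (by simpa)
  rw [intervalIntegrable_iff_integrableOn_Ioo_of_le zero_le_one] at h
  have h2 := (h.congr_fun (fun t ht => beta_cpow_eq ht) measurableSet_Ioo).re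
  simpa [IntegrableOn] using h2

lemma beta_value {a b : ℝ} (ha : 0 < a) (hb : 0 < b) :
    ∫ t in Ioo (0:ℝ) 1, t ^ (a - 1) * (1 - t) ^ (b - 1)
      = Gamma a * Gamma b / Gamma (a + b) := by
  have h := ProbabilityTheory.beta_eq_betaIntegralReal a b ha hb
  rw [ProbabilityTheory.beta] at h
  rw [h, Complex.betaIntegral, intervalIntegral.integral_of_le zero_le_one,
    integral_Ioc_eq_integral_Ioo, setIntegral_congr_fun measurableSet_Ioo
      (fun t ht => beta_cpow_eq ht), integral_complex_ofReal, Complex.ofReal_re]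

noncomputable def F (a : ℝ) : ℝ := ∫ t in Ioo (0:ℝ) 1, t ^ (a - 1) * (1 - t) ^ ((1/2:ℝ) - 1)
noncomputable def dF (a : ℝ) : ℝ :=
  ∫ t in Ioo (0:ℝ) 1, t ^ (a - 1) * log t * (1 - t) ^ ((1/2:ℝ) - 1)

lemma F_eq {a : ℝ} (ha : 0 < a) : F a = Gamma a * √π / Gamma (a + 1/2) := by
  rw [F, beta_value ha (by norm_num), Gamma_one_half_eq]

lemma F_deriv {a : ℝ} (ha : 0 < a) :
    IntegrableOn (fun t : ℝ => t ^ (a - 1) * log t * (1 - t) ^ ((1/2:ℝ) - 1)) (Ioo 0 1) ∧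
    HasDerivAt F (dF a) a := by
  have hs : Ioi (a/2) ∈ nhds a := Ioi_mem_nhds (by linarith)
  have hm : ∀ b : ℝ, AEStronglyMeasurable
      (fun t : ℝ => t ^ (b - 1) * (1 - t) ^ ((1/2:ℝ) - 1)) (volume.restrict (Ioo 0 1)) :=
    fun b => Measurable.aestronglyMeasurable (by fun_prop)
  refine hasDerivAt_integral_of_dominated_loc_of_deriv_le
    (F := fun a t : ℝ => t ^ (a - 1) * (1 - t) ^ ((1/2:ℝ) - 1))
    (F' := fun a t : ℝ => t ^ (a - 1) * log t * (1 - t) ^ ((1/2:ℝ) - 1))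
    (bound := fun t : ℝ => (4/a) * (t ^ (a/4 - 1) * (1 - t) ^ ((1/2:ℝ) - 1)))
    (μ := volume.restrict (Ioo 0 1)) hs (Filter.Eventually.of_forall hm)
    (beta_integrable ha (by norm_num)) (Measurable.aestronglyMeasurable (by fun_prop)) ?_
    ((beta_integrable (a := a/4) (by linarith) (by norm_num)).const_mul _) ?_
  · refine (ae_restrict_iff' measurableSet_Ioo).2 (Filter.Eventually.of_forall ?_)
    intro t ht b hb
    have hb' : a/2 < b := hb
    have h1 : (0:ℝ) ≤ 1 - t := by linarith [ht.2]
    have h2 := abs_log_mul_self_rpow_lt t (a/4) ht.1 ht.2.le (by linarith)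
    have h3 : t ^ (b - 1) ≤ t ^ (a/4) * t ^ (a/4 - 1) := by
      rw [← rpow_add ht.1]
      exact rpow_le_rpow_of_exponent_ge ht.1 ht.2.le (by linarith)
    have h4 : 0 ≤ t ^ (a/4) := rpow_nonneg ht.1.le _
    have h5 : 0 ≤ t ^ (a/4-1) := rpow_nonneg ht.1.le _
    have h6 : 0 ≤ (1-t) ^ ((1/2:ℝ)-1) := rpow_nonneg h1 _
    have h7 : 0 ≤ t ^ (b-1) := rpow_nonneg ht.1.le _
    rw [abs_mul, abs_of_nonneg h4] at h2
    rw [norm_eq_abs, abs_mul, abs_mul, abs_of_nonneg h6, abs_of_nonneg h7, ← mul_assoc]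
    refine mul_le_mul_of_nonneg_right ?_ h6
    calc t ^ (b-1) * |log t| ≤ (t ^ (a/4) * t ^ (a/4 - 1)) * |log t| := by gcongr
      _ = (|log t| * t ^ (a/4)) * t ^ (a/4 - 1) := by ring
      _ ≤ (1 / (a/4)) * t ^ (a/4 - 1) := by gcongr
      _ = _ := by congr 1; field_simp
  · refine (ae_restrict_iff' measurableSet_Ioo).2 (Filter.Eventually.of_forall ?_)
    intro t ht b hb
    have h := ((hasDerivAt_id b).sub_const 1).const_rpow ht.1
    convert! h.mul_const ((1 - t) ^ ((1/2:ℝ) - 1)) using 1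
    simp only [id]
    ring

lemma G14 : Gamma (1/4) * Gamma (3/4) = π * √2 := by
  have h := Gamma_mul_Gamma_one_sub (1/4)
  rw [show (1:ℝ) - 1/4 = 3/4 by norm_num, show π * (1/4) = π / 4 by ring, sin_pi_div_four] at h
  rw [h]
  have : √2 * √2 = 2 := mul_self_sqrt (by norm_num)
  field_simp
  nlinarith

lemma dG {a : ℝ} (ha : 0 < a) : HasDerivAt Gamma (deriv Gamma a) a :=
  (differentiableAt_Gamma (fun m => by
    have : (0:ℝ) ≤ m := by positivity
    linarith)).hasDerivAt

lemma dF14 : dF (1/4) = - π * F (1/4) := by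
  have g1 := dG (show (0:ℝ) < 1/4 by norm_num)
  have g3 := dG (show (0:ℝ) < 3/4 by norm_num)
  have p1 : 0 < Gamma (1/4) := Gamma_pos_of_pos (by norm_num)
  have p3 : 0 < Gamma (3/4) := Gamma_pos_of_pos (by norm_num)
  have h2 : √2 * √2 = 2 := mul_self_sqrt (by norm_num)
  -- reflection
  have r1 : HasDerivAt (fun a : ℝ => Gamma a * Gamma (1 - a))
      (deriv Gamma (1/4) * Gamma (3/4) + Gamma (1/4) * (deriv Gamma (3/4) * (-1))) (1/4) := by
    have e : (1:ℝ) - 1/4 = 3/4 := by norm_num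
    have k : HasDerivAt (fun a : ℝ => Gamma (1 - a)) (deriv Gamma (3/4) * (-1)) (1/4) := by
      refine HasDerivAt.comp (1/4:ℝ) (h₂ := Gamma) (h := fun a : ℝ => 1 - a) ?_ ?_
      · rw [e]; exact g3
      · exact (hasDerivAt_id _).const_sub 1
    have := g1.mul k
    rw [e] at this
    exact this
  have r2 : HasDerivAt (fun a : ℝ => π / sin (π * a)) (-(π * (cos (π/4) * π)) / (sin (π/4))^2)
      (1/4) := by
    have hs : HasDerivAt (fun a : ℝ => sin (π * a)) (cos (π/4) * π) (1/4) := by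
      have := ((hasDerivAt_id (1/4:ℝ)).const_mul π).sin
      simpa [div_eq_mul_inv] using this
    have hne : sin (π * (1/4)) ≠ 0 := by
      rw [show π * (1/4) = π / 4 by ring, sin_pi_div_four]; positivity
    have := (hasDerivAt_const (1/4:ℝ) π).div hs hne
    rw [show π * (1/4) = π / 4 by ring] at this
    convert! this using 1
    simp
  have r3 : (fun a : ℝ => Gamma a * Gamma (1 - a)) = fun a : ℝ => π / sin (π * a) :=
    funext fun a => Gamma_mul_Gamma_one_sub a
  rw [r3] at r1
  have r := r1.unique r2
  rw [sin_pi_div_four, cos_pi_div_four] at r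
  -- derivative of F
  have e : (1/4:ℝ) + 1/2 = 3/4 := by norm_num
  have k : HasDerivAt (fun a : ℝ => Gamma (a + 1/2)) (deriv Gamma (3/4)) (1/4) := by
    refine HasDerivAt.comp_add_const (1/4:ℝ) (1/2) ?_
    rw [e]; exact g3
  have q := (g1.mul_const √π).div k (by rw [e]; exact p3.ne')
  have q2 : HasDerivAt F (dF (1/4)) (1/4) := (F_deriv (by norm_num)).2
  have q3 : F =ᶠ[nhds (1/4:ℝ)] (fun a => Gamma a * √π / Gamma (a + 1/2)) := by
    filter_upwards [Ioi_mem_nhds (show (0:ℝ) < 1/4 by norm_num)] with a ha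
    exact F_eq ha
  have q4 := (q2.congr_of_eventuallyEq q3.symm).unique q
  rw [q4, F_eq (by norm_num), e]
  have G := G14
  have r' : deriv Gamma (1/4) * Gamma (3/4) - Gamma (1/4) * deriv Gamma (3/4)
      = - π * (Gamma (1/4) * Gamma (3/4)) := by
    rw [G]
    have : -(π * (√2 / 2 * π)) / (√2 / 2) ^ 2 = -π * (π * √2) := by
      rw [div_pow, sq √2, h2]; ring
    rw [← this, ← r]; ring
  field_simp
  linear_combination r'

lemma FF {a : ℝ} (ha : 0 < a) : F a * F (a + 1/2) = π / a := by
  have p1 : 0 < Gamma a := Gamma_pos_of_pos ha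
  have p3 : 0 < Gamma (a + 1/2) := Gamma_pos_of_pos (by linarith)
  have h : √π * √π = π := mul_self_sqrt pi_pos.le
  rw [F_eq ha, F_eq (by linarith), show a + 1/2 + 1/2 = a + 1 by ring, Gamma_add_one ha.ne']
  field_simp
  nlinarith

lemma dF34 : dF (1/4) * F (3/4) + F (1/4) * dF (3/4) = -16 * π := by
  have e : (1/4:ℝ) + 1/2 = 3/4 := by norm_num
  have q1 : HasDerivAt F (dF (1/4)) (1/4) := (F_deriv (by norm_num)).2
  have q3 : HasDerivAt F (dF (3/4)) (3/4) := (F_deriv (by norm_num)).2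
  have k : HasDerivAt (fun a : ℝ => F (a + 1/2)) (dF (3/4)) (1/4) := by
    refine HasDerivAt.comp_add_const (1/4:ℝ) (1/2) ?_
    rw [e]; exact q3
  have m := q1.mul k
  have d := (hasDerivAt_const (1/4:ℝ) π).div (hasDerivAt_id (1/4:ℝ)) (by norm_num)
  have ev : (fun a : ℝ => F a * F (a + 1/2)) =ᶠ[nhds (1/4:ℝ)] (fun a => π / a) := by
    filter_upwards [Ioi_mem_nhds (show (0:ℝ) < 1/4 by norm_num)] with a ha
    exact FF ha
  have := (m.congr_of_eventuallyEq ev.symm).unique d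
  rw [e] at this
  rw [this]
  norm_num
  ring


/-- `√(1 - z²)` and `√(1 + z²)`. -/
noncomputable def p (z : ℝ) : ℝ := √(1 - z ^ 2)
noncomputable def q (z : ℝ) : ℝ := √(1 + z ^ 2)
noncomputable def S (z : ℝ) : ℝ := 1 / (p z * q z)
noncomputable def w (z : ℝ) : ℝ := p z / q z

lemma q_pos (z : ℝ) : 0 < q z := sqrt_pos.2 (by positivity)
lemma q_sq (z : ℝ) : q z ^ 2 = 1 + z ^ 2 := sq_sqrt (by positivity)
lemma p_pos {z : ℝ} (hz : z ∈ Ioo (0:ℝ) 1) : 0 < p z :=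
  sqrt_pos.2 (by nlinarith [hz.1, hz.2])
lemma p_sq {z : ℝ} (hz : z ∈ Ioo (0:ℝ) 1) : p z ^ 2 = 1 - z ^ 2 :=
  sq_sqrt (by nlinarith [hz.1, hz.2])
lemma p_cont : Continuous p := by unfold p; fun_prop
lemma q_cont : Continuous q := by unfold q; fun_prop
lemma w_cont : Continuous w := p_cont.div q_cont (fun z => (q_pos z).ne')
lemma S_meas : Measurable S := by
  unfold S
  exact measurable_const.div (p_cont.measurable.mul q_cont.measurable)
lemma S_pos {z : ℝ} (hz : z ∈ Ioo (0:ℝ) 1) : 0 < S z :=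
  one_div_pos.2 (mul_pos (p_pos hz) (q_pos z))

lemma q_deriv (z : ℝ) : HasDerivAt q (z / q z) z := by
  have h : HasDerivAt (fun z : ℝ => 1 + z ^ 2) (2 * z) z := by
    simpa using (hasDerivAt_pow 2 z).const_add 1
  convert! h.sqrt (by positivity) using 1
  rw [q]; field_simp
lemma p_deriv {z : ℝ} (hz : z ∈ Ioo (0:ℝ) 1) : HasDerivAt p (- z / p z) z := by
  have h : HasDerivAt (fun z : ℝ => 1 - z ^ 2) (-(2 * z)) z := by
    simpa using (hasDerivAt_pow 2 z).const_sub 1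
  convert! h.sqrt (by nlinarith [hz.1, hz.2]) using 1
  rw [p]; field_simp
lemma w_deriv {z : ℝ} (hz : z ∈ Ioo (0:ℝ) 1) : HasDerivAt w (- (2 * z * S z / q z ^ 2)) z := by
  convert! (p_deriv hz).div (q_deriv z) (q_pos z).ne' using 1
  have := p_pos hz
  have := q_pos z
  have h1 := p_sq hz
  have h2 := q_sq z
  rw [S]
  field_simp
  rw [h1, h2]; ring

lemma w_sq {z : ℝ} (hz : z ∈ Ioo (0:ℝ) 1) : w z ^ 2 = (1 - z ^ 2) / (1 + z ^ 2) := by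
  rw [w, div_pow, p_sq hz, q_sq]

lemma w_mem {z : ℝ} (hz : z ∈ Ioo (0:ℝ) 1) : w z ∈ Ioo (0:ℝ) 1 := by
  have h : 0 < w z := div_pos (p_pos hz) (q_pos z)
  refine ⟨h, ?_⟩
  have h2 : w z ^ 2 < 1 := by
    rw [w_sq hz, div_lt_one (by positivity)]
    nlinarith [hz.1]
  nlinarith

lemma w_w {z : ℝ} (hz : z ∈ Ioo (0:ℝ) 1) : w (w z) = z := by
  have h : w (w z) ^ 2 = z ^ 2 := by
    rw [w_sq (w_mem hz), w_sq hz]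
    have : 1 + z ^ 2 ≠ 0 := by positivity
    have h3 : 1 + (1 - z ^ 2) / (1 + z ^ 2) = 2 / (1 + z ^ 2) := by field_simp; ring
    rw [h3]
    field_simp
    ring
  exact (sq_eq_sq₀ (w_mem (w_mem hz)).1.le hz.1.le).1 h

/-- change of variables on the open unit interval -/
lemma cov (φ ψ φ' : ℝ → ℝ) (h1 : ∀ z ∈ Ioo (0:ℝ) 1, φ z ∈ Ioo (0:ℝ) 1)
    (h2 : ∀ z ∈ Ioo (0:ℝ) 1, ψ z ∈ Ioo (0:ℝ) 1)
    (h3 : ∀ z ∈ Ioo (0:ℝ) 1, ψ (φ z) = z) (h4 : ∀ z ∈ Ioo (0:ℝ) 1, φ (ψ z) = z)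
    (hd : ∀ z ∈ Ioo (0:ℝ) 1, HasDerivAt φ (φ' z) z) (g h : ℝ → ℝ)
    (hgh : ∀ z ∈ Ioo (0:ℝ) 1, |φ' z| * g (φ z) = h z) :
    (∫ x in Ioo (0:ℝ) 1, g x = ∫ z in Ioo (0:ℝ) 1, h z) ∧
    (IntegrableOn g (Ioo 0 1) ↔ IntegrableOn h (Ioo 0 1)) := by
  have im : φ '' Ioo 0 1 = Ioo 0 1 := by
    ext x; constructor
    · rintro ⟨z, hz, rfl⟩; exact h1 z hz
    · intro hx; exact ⟨ψ x, h2 x hx, h4 x hx⟩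
  have inj : InjOn φ (Ioo 0 1) := fun x hx y hy hxy => by
    rw [← h3 x hx, ← h3 y hy, hxy]
  have hd' : ∀ z ∈ Ioo (0:ℝ) 1, HasDerivWithinAt φ (φ' z) (Ioo 0 1) z :=
    fun z hz => (hd z hz).hasDerivWithinAt
  have a := integral_image_eq_integral_abs_deriv_smul measurableSet_Ioo hd' inj g
  have b := integrableOn_image_iff_integrableOn_abs_deriv_smul measurableSet_Ioo hd' inj g
  rw [im] at a b
  refine ⟨a.trans (setIntegral_congr_fun measurableSet_Ioo fun z hz => hgh z hz), b.trans ?_⟩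
  exact integrableOn_congr_fun (fun z hz => hgh z hz) measurableSet_Ioo

lemma cov_w (f : ℝ → ℝ) :
    ∫ z in Ioo (0:ℝ) 1, f z * S z = ∫ z in Ioo (0:ℝ) 1, f (w z) * S z := by
  refine (cov w w (fun z => - (2 * z * S z / q z ^ 2)) (fun z hz => w_mem hz)
    (fun z hz => w_mem hz) (fun z hz => w_w hz) (fun z hz => w_w hz) (fun z hz => w_deriv hz)
    _ _ ?_).1
  intro z hz
  have hS := S_pos hz
  have hq := q_pos z
  have hz0 := hz.1
  rw [abs_neg, abs_of_pos (by positivity)]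
  have e1 : p (w z) * q (w z) = 2 * z / q z ^ 2 := by
    have hp := p_pos (w_mem hz)
    have hq' := q_pos (w z)
    have : (p (w z) * q (w z)) ^ 2 = (2 * z / q z ^ 2) ^ 2 := by
      rw [mul_pow, p_sq (w_mem hz), q_sq, w_sq hz, q_sq]
      field_simp; ring
    exact (sq_eq_sq₀ (by positivity) (by positivity)).1 this
  have e2 : S (w z) = q z ^ 2 / (2 * z) := by rw [S, e1, one_div_div]
  rw [e2]
  field_simp

/-- substitution `t = z ^ 4` -/
lemma cov_four (f : ℝ → ℝ) (a : ℝ) :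
    (∫ t in Ioo (0:ℝ) 1, t ^ (a - 1) * f t * (1 - t) ^ ((1/2:ℝ) - 1)
      = ∫ z in Ioo (0:ℝ) 1, 4 * (z ^ (4 * a - 1) * f (z ^ 4) * S z)) ∧
    (IntegrableOn (fun t : ℝ => t ^ (a - 1) * f t * (1 - t) ^ ((1/2:ℝ) - 1)) (Ioo 0 1) ↔
      IntegrableOn (fun z : ℝ => 4 * (z ^ (4 * a - 1) * f (z ^ 4) * S z)) (Ioo 0 1)) := by
  refine cov (fun z => z ^ 4) (fun z => z ^ (1/4:ℝ)) (fun z => 4 * z ^ 3) ?_ ?_ ?_ ?_ ?_ _ _ ?_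
  · intro z hz
    exact ⟨pow_pos hz.1 4, pow_lt_one₀ hz.1.le hz.2 (by norm_num)⟩
  · intro z hz
    exact ⟨rpow_pos_of_pos hz.1 _, rpow_lt_one hz.1.le hz.2 (by norm_num)⟩
  · intro z hz
    rw [← rpow_natCast, ← rpow_mul hz.1.le]; norm_num
  · intro z hz
    rw [← rpow_natCast, ← rpow_mul hz.1.le]; norm_num
  · intro z hz
    simpa using hasDerivAt_pow 4 z
  · intro z hz
    have hz0 := hz.1
    have hp := p_pos hz
    have hq := q_pos z
    have e1 : (1 - z ^ 4) ^ ((1/2:ℝ) - 1) = S z := by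
      have : 1 - z ^ 4 = (p z * q z) ^ 2 := by rw [mul_pow, p_sq hz, q_sq]; ring
      rw [this, ← rpow_natCast, ← rpow_mul (by positivity), S]
      norm_num
      rw [rpow_neg_one, mul_inv]; ring
    have e2 : z ^ 3 * (z ^ 4) ^ (a - 1) = z ^ (4 * a - 1) := by
      rw [← rpow_natCast, ← rpow_natCast, ← rpow_mul hz0.le, ← rpow_add hz0]
      congr 1; push_cast; ring
    rw [abs_of_pos (by positivity), e1, ← e2]
    ring

lemma S_int : IntegrableOn S (Ioo 0 1) ∧ ∫ z in Ioo (0:ℝ) 1, S z = F (1/4) / 4 := by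
  have h := cov_four (fun _ => 1) (1/4)
  norm_num at h
  constructor
  · have := h.2.1 (by
      have := beta_integrable (show (0:ℝ) < 1/4 by norm_num) (show (0:ℝ) < 1/2 by norm_num)
      norm_num at this; exact this)
    simpa [IntegrableOn] using this.const_mul (1/4)
  · rw [F]; norm_num; rw [h.1, integral_const_mul]; ring

lemma zS_int : ∫ z in Ioo (0:ℝ) 1, z ^ 2 * S z = F (3/4) / 4 := by
  have h := cov_four (fun _ => 1) (3/4)
  norm_num at h
  rw [F]; norm_num; rw [h.1, integral_const_mul]; ring

lemma logS_int : IntegrableOn (fun z => log z * S z) (Ioo 0 1) ∧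
    ∫ z in Ioo (0:ℝ) 1, log z * S z = dF (1/4) / 16 := by
  have h := cov_four log (1/4)
  norm_num at h
  constructor
  · have := h.2.1 (by
      have := (F_deriv (show (0:ℝ) < 1/4 by norm_num)).1
      norm_num at this; exact this)
    have := this.const_mul (1/16)
    refine Integrable.congr this (Filter.Eventually.of_forall fun z => ?_)
    ring
  · rw [dF]; norm_num; rw [h.1, integral_const_mul]
    rw [show (∫ z in Ioo (0:ℝ) 1, 4 * log z * S z) = 4 * ∫ z in Ioo (0:ℝ) 1, log z * S z by
      rw [← integral_const_mul]; congr 1; ext; ring]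
    ring

lemma zlogS_int : ∫ z in Ioo (0:ℝ) 1, z ^ 2 * (log z * S z) = dF (3/4) / 16 := by
  have h := cov_four log (3/4)
  norm_num at h
  rw [dF]; norm_num; rw [h.1, integral_const_mul]
  rw [show (∫ z in Ioo (0:ℝ) 1, z ^ 2 * (4 * log z) * S z)
      = 4 * ∫ z in Ioo (0:ℝ) 1, z ^ 2 * (log z * S z) by
    rw [← integral_const_mul]; congr 1; ext; ring]
  ring

/-- bounded continuous multiples of integrable functions are integrable -/
lemma int_mul {f g : ℝ → ℝ} (hf : IntegrableOn f (Ioo 0 1)) (hg : Continuous g) :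
    IntegrableOn (fun z => g z * f z) (Ioo 0 1) := by
  have h := (integrableOn_Icc_iff_integrableOn_Ioo (μ := volume)).2 hf
  exact (h.continuousOn_mul hg.continuousOn isCompact_Icc).mono_set Ioo_subset_Icc_self

noncomputable def l (z : ℝ) : ℝ := log (1 + z ^ 2)
lemma l_cont : Continuous l := by
  unfold l
  exact Continuous.log (by fun_prop) (fun z => by positivity)
lemma l_deriv (z : ℝ) : HasDerivAt l (2 * z / (1 + z ^ 2)) z := by
  have h : HasDerivAt (fun z : ℝ => 1 + z ^ 2) (2 * z) z := by
    simpa using (hasDerivAt_pow 2 z).const_add 1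
  exact h.log (by positivity)
lemma l_w {z : ℝ} (hz : z ∈ Ioo (0:ℝ) 1) : l (w z) = log 2 - l z := by
  rw [l, l, w_sq hz, ← log_div (by norm_num) (by positivity)]
  congr 1; field_simp; ring

lemma M0 : ∫ z in Ioo (0:ℝ) 1, l z * S z = log 2 / 2 * (F (1/4) / 4) := by
  have h := cov_w l
  have i1 := int_mul S_int.1 l_cont
  have : ∫ z in Ioo (0:ℝ) 1, l (w z) * S z
      = ∫ z in Ioo (0:ℝ) 1, (log 2 * S z - l z * S z) :=
    setIntegral_congr_fun measurableSet_Ioo fun z hz => by rw [l_w hz]; ring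
  rw [this, integral_sub (S_int.1.const_mul _) i1, integral_const_mul, S_int.2] at h
  linarith

lemma M2 : ∫ z in Ioo (0:ℝ) 1, (z ^ 2 * l z) * S z
    = log 2 / 2 * (F (3/4) / 4) + F (1/4) / 4 - 2 * (F (3/4) / 4) := by
  have h := cov_w (fun z => z ^ 2 * l z)
  have i1 : IntegrableOn (fun z => (z ^ 2 * l z) * S z) (Ioo 0 1) :=
    int_mul S_int.1 (by have := l_cont; fun_prop)
  have i2 : IntegrableOn (fun z => z ^ 2 * S z) (Ioo 0 1) := int_mul S_int.1 (by fun_prop)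
  -- total derivative
  have cR : Continuous (fun z : ℝ => ((1 - z ^ 2) / (1 + z ^ 2) * (log 2 - l z)
      - z ^ 2 * (log 2 - l z) - (2 - 4 * z ^ 2))) := by
    have := l_cont
    have h3 : Continuous (fun z : ℝ => (1 - z ^ 2) / (1 + z ^ 2)) :=
      Continuous.div (by fun_prop) (by fun_prop) (fun z => by positivity)
    fun_prop
  have iR := int_mul S_int.1 cR
  have hR : ∫ z in (0:ℝ)..1, ((1 - z ^ 2) / (1 + z ^ 2) * (log 2 - l z)
      - z ^ 2 * (log 2 - l z) - (2 - 4 * z ^ 2)) * S z = 0 := by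
    rw [intervalIntegral.integral_eq_sub_of_hasDerivAt_of_le zero_le_one
      (f := fun z => z * w z * (log 2 - l z - 2))]
    · simp [w, p]
    · have := l_cont
      have := w_cont
      exact Continuous.continuousOn (by fun_prop)
    · intro z hz
      convert! ((hasDerivAt_id z).mul (w_deriv hz)).mul (((l_deriv z).const_sub (log 2)).sub_const 2)
        using 1
      have hw : w z = (1 - z ^ 2) * S z := by
        have := p_pos hz
        have := q_pos z
        rw [w, S, ← p_sq hz]; field_simp
      simp only [id, Pi.mul_apply]
      rw [hw, q_sq]
      field_simp
      ring
    · rw [intervalIntegrable_iff_integrableOn_Ioo_of_le zero_le_one]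
      exact iR
  rw [intervalIntegral.integral_of_le zero_le_one, integral_Ioc_eq_integral_Ioo] at hR
  have e : ∫ z in Ioo (0:ℝ) 1, ((w z) ^ 2 * l (w z)) * S z
      = ∫ z in Ioo (0:ℝ) 1, ((((1 - z ^ 2) / (1 + z ^ 2) * (log 2 - l z)
      - z ^ 2 * (log 2 - l z) - (2 - 4 * z ^ 2)) * S z) + (2 * S z + ((log 2 - 4) * (z ^ 2 * S z)
        - (z ^ 2 * l z) * S z))) :=
    setIntegral_congr_fun measurableSet_Ioo fun z hz => by
      rw [l_w hz, w_sq hz]; ring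
  rw [e, integral_add iR, hR, integral_add (S_int.1.const_mul _), integral_sub (i2.const_mul _) i1,
    integral_const_mul, integral_const_mul, S_int.2, zS_int] at h
  · linarith
  · exact (i2.const_mul _).sub i1
  · exact (S_int.1.const_mul _).add ((i2.const_mul _).sub i1)

lemma main_sub :
    ∫ x in Ioo (0:ℝ) 1, √(1 - x ^ 2) * log x / (2 - x ^ 2) ^ ((3 : ℝ) / 2)
      = ∫ z in Ioo (0:ℝ) 1, (1/4) * ((1 - z ^ 2) * (log 2 + 2 * log z - l z) * S z) := by
  have s2 : √2 ^ 2 = 2 := sq_sqrt (by norm_num)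
  have s2p : 0 < √2 := by positivity
  have x_sq : ∀ z : ℝ, (√2 * z / q z) ^ 2 = 2 * z ^ 2 / (1 + z ^ 2) := by
    intro z; rw [div_pow, mul_pow, s2, q_sq]
  have y_sq : ∀ x ∈ Ioo (0:ℝ) 1, (x / √(2 - x ^ 2)) ^ 2 = x ^ 2 / (2 - x ^ 2) := by
    intro x hx
    rw [div_pow, sq_sqrt (by nlinarith [hx.1, hx.2])]
  have xm : ∀ z ∈ Ioo (0:ℝ) 1, √2 * z / q z ∈ Ioo (0:ℝ) 1 := by
    intro z hz
    have hz0 := hz.1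
    have hq := q_pos z
    have h : 0 < √2 * z / q z := by positivity
    refine ⟨h, ?_⟩
    have : (√2 * z / q z) ^ 2 < 1 := by
      rw [x_sq, div_lt_one (by positivity)]; nlinarith [hz.1, hz.2]
    nlinarith
  have ym : ∀ x ∈ Ioo (0:ℝ) 1, x / √(2 - x ^ 2) ∈ Ioo (0:ℝ) 1 := by
    intro x hx
    have h2 : 0 < 2 - x ^ 2 := by nlinarith [hx.1, hx.2]
    have hx0 := hx.1
    have h : 0 < x / √(2 - x ^ 2) := by positivity
    refine ⟨h, ?_⟩
    have : (x / √(2 - x ^ 2)) ^ 2 < 1 := by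
      rw [y_sq x hx, div_lt_one h2]; nlinarith [hx.1, hx.2]
    nlinarith
  refine (cov (fun z => √2 * z / q z) (fun x => x / √(2 - x ^ 2)) (fun z => √2 / q z ^ 3)
    xm ym ?_ ?_ ?_ _ _ ?_).1
  · intro z hz
    refine (sq_eq_sq₀ (ym _ (xm z hz)).1.le hz.1.le).1 ?_
    rw [y_sq _ (xm z hz), x_sq]
    have h3 : 2 - 2 * z ^ 2 / (1 + z ^ 2) = 2 / (1 + z ^ 2) := by field_simp; ring
    rw [h3]; field_simp
  · intro x hx
    refine (sq_eq_sq₀ (xm _ (ym x hx)).1.le hx.1.le).1 ?_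
    rw [x_sq, y_sq x hx]
    have h2 : 0 < 2 - x ^ 2 := by nlinarith [hx.1, hx.2]
    have h3 : 1 + x ^ 2 / (2 - x ^ 2) = 2 / (2 - x ^ 2) := by field_simp; ring
    rw [h3]; field_simp
  · intro z hz
    have hq := q_pos z
    convert! (((hasDerivAt_id z).const_mul √2).div (q_deriv z) hq.ne') using 1
    simp only [id]
    field_simp
    rw [q_sq]; ring
  · intro z hz
    have hq := q_pos z
    have hp := p_pos hz
    have hz0 := hz.1
    rw [abs_of_pos (by positivity), x_sq]
    have e1 : √(1 - 2 * z ^ 2 / (1 + z ^ 2)) = p z / q z := by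
      rw [show 1 - 2 * z ^ 2 / (1 + z ^ 2) = (p z / q z) ^ 2 by
        rw [div_pow, p_sq hz, q_sq]; field_simp; ring]
      exact sqrt_sq (by positivity)
    have e2 : (2 - 2 * z ^ 2 / (1 + z ^ 2)) ^ ((3:ℝ)/2) = (√2 / q z) ^ 3 := by
      rw [show 2 - 2 * z ^ 2 / (1 + z ^ 2) = (√2 / q z) ^ 2 by
        rw [div_pow, s2, q_sq]; field_simp; ring]
      rw [← rpow_natCast, ← rpow_mul (by positivity), ← rpow_natCast]
      norm_num
    have e3 : log (√2 * z / q z) = (1/2) * (log 2 + 2 * log z - l z) := by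
      rw [log_div (by positivity) hq.ne', log_mul s2p.ne' hz0.ne', log_sqrt (by norm_num), q,
        log_sqrt (by positivity), l]
      ring
    rw [e1, e2, e3, S, ← p_sq hz]
    field_simp
    rw [s2]; ring

end S18

theorem stmt18 :
    ∫ x in (0 : ℝ)..1, Real.sqrt (1 - x ^ 2) * Real.log x / (2 - x ^ 2) ^ ((3 : ℝ) / 2)
      = Real.Gamma (1 / 4) ^ 2 * (4 - 2 * π + 2 * Real.log 2) / (64 * Real.sqrt (2 * π))
        - π ^ ((3 : ℝ) / 2) * (π + Real.log 2) / (4 * Real.sqrt 2 * Real.Gamma (1 / 4) ^ 2) := by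
  rw [intervalIntegral.integral_of_le zero_le_one, integral_Ioc_eq_integral_Ioo, S18.main_sub]
  have i0 := S18.S_int.1
  have i2 : IntegrableOn (fun z => z ^ 2 * S18.S z) (Ioo 0 1) := S18.int_mul i0 (by fun_prop)
  have j0 := S18.logS_int.1
  have j2 : IntegrableOn (fun z => z ^ 2 * (log z * S18.S z)) (Ioo 0 1) :=
    S18.int_mul j0 (by fun_prop)
  have k0 := S18.int_mul i0 S18.l_cont
  have k2 : IntegrableOn (fun z => (z ^ 2 * S18.l z) * S18.S z) (Ioo 0 1) :=
    S18.int_mul i0 (by have := S18.l_cont; fun_prop)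
  have e : ∀ z : ℝ, (1/4) * ((1 - z ^ 2) * (log 2 + 2 * log z - S18.l z) * S18.S z)
      = (((log 2 / 4) * S18.S z - (log 2 / 4) * (z ^ 2 * S18.S z))
        + ((1/2) * (log z * S18.S z) - (1/2) * (z ^ 2 * (log z * S18.S z))))
        - ((1/4) * (S18.l z * S18.S z) - (1/4) * ((z ^ 2 * S18.l z) * S18.S z)) := by
    intro z; ring
  simp_rw [e]
  have a1 : Integrable (fun z => (log 2 / 4) * S18.S z - (log 2 / 4) * (z ^ 2 * S18.S z))
      (volume.restrict (Ioo 0 1)) := (i0.const_mul (log 2 / 4)).sub (i2.const_mul (log 2 / 4))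
  have a2 : Integrable (fun z => (1/2) * (log z * S18.S z) - (1/2) * (z ^ 2 * (log z * S18.S z)))
      (volume.restrict (Ioo 0 1)) := (j0.const_mul (1/2)).sub (j2.const_mul (1/2))
  have a3 : Integrable (fun z => (1/4) * (S18.l z * S18.S z) - (1/4) * ((z ^ 2 * S18.l z) * S18.S z))
      (volume.restrict (Ioo 0 1)) := (k0.const_mul (1/4)).sub (k2.const_mul (1/4))
  rw [integral_sub (a1.fun_add a2) a3, integral_add a1 a2,
    integral_sub (i0.const_mul (log 2 / 4)) (i2.const_mul (log 2 / 4)),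
    integral_sub (j0.const_mul (1/2)) (j2.const_mul (1/2)),
    integral_sub (k0.const_mul (1/4)) (k2.const_mul (1/4))]
  simp only [integral_const_mul]
  rw [S18.S_int.2, S18.zS_int, S18.logS_int.2, S18.zlogS_int, S18.M0, S18.M2]
  have g1 : 0 < Gamma (1/4) := Gamma_pos_of_pos (by norm_num)
  have g3 : 0 < Gamma (3/4) := Gamma_pos_of_pos (by norm_num)
  have f1 : S18.F (1/4) = Gamma (1/4) ^ 2 / (√2 * √π) := by
    rw [S18.F_eq (by norm_num), show (1/4:ℝ) + 1/2 = 3/4 by norm_num,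
      div_eq_div_iff g3.ne' (by positivity)]
    have h : √π ^ 2 = π := sq_sqrt pi_pos.le
    linear_combination (Gamma (1/4) * √2) * h - Gamma (1/4) * S18.G14
  have f1p : 0 < S18.F (1/4) := by rw [f1]; positivity
  have f13 : S18.F (1/4) * S18.F (3/4) = 4 * π := by
    have := S18.FF (show (0:ℝ) < 1/4 by norm_num)
    rw [show (1/4:ℝ) + 1/2 = 3/4 by norm_num] at this
    rw [this]; ring
  have d1 := S18.dF14
  have d3 : S18.dF (3/4) = (π - 4) * S18.F (3/4) := by
    have := S18.dF34
    rw [d1] at this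
    refine mul_left_cancel₀ f1p.ne' ?_
    linear_combination this + 4 * f13
  have f3 : S18.F (3/4) = 4 * π * (√2 * √π) / Gamma (1/4) ^ 2 := by
    rw [f1] at f13
    field_simp at f13 ⊢
    linear_combination f13
  have hpi : π ^ ((3:ℝ)/2) = π * √π := by
    rw [show (3:ℝ)/2 = 1 + 1/2 by norm_num, rpow_add pi_pos, rpow_one, sqrt_eq_rpow]
  have t2 : √2 ^ 2 = 2 := sq_sqrt (by norm_num)
  rw [d1, d3, f1, f3, hpi, sqrt_mul (by norm_num)]
  have e5 : π * √π * (π + log 2) / (4 * √2 * Gamma (1/4) ^ 2)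
      = π * √π * (π + log 2) * √2 / (8 * Gamma (1/4) ^ 2) := by
    field_simp
    rw [t2]; ring
  rw [e5]
  field_simp
  ring
end

section
/- The integral ∫_0^1 √(1−x²)·(x² − 4)·ln(x) / (2−x²)^{3/2} dx equals √2·π^{3/2}/Γ(1/4)^2 + (√(π/2)/16 − ln 2/(16√(2π)))·Γ(1/4)^2. -/
open Real

open MeasureTheory Set in
lemma beta_real (a b : ℝ) (ha : 0 < a) (hb : 0 < b) :
    IntegrableOn (fun v : ℝ => v ^ (a-1) * (1-v) ^ (b-1)) (Ioo 0 1) ∧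
    ∫ v in Ioo (0:ℝ) 1, v ^ (a-1) * (1-v) ^ (b-1)
      = Real.Gamma a * Real.Gamma b / Real.Gamma (a+b) := by
  have hc := Complex.betaIntegral_convergent (u := a) (v := b) (by simpa) (by simpa)
  have hI : IntegrableOn (fun v : ℝ => (((v ^ (a-1) * (1-v) ^ (b-1) : ℝ)) : ℂ)) (Ioo 0 1) := by
    rw [intervalIntegrable_iff_integrableOn_Ioo_of_le zero_le_one] at hc
    refine hc.congr_fun ?_ measurableSet_Ioo
    intro x hx
    have h1 : 0 ≤ x := hx.1.le
    have h2 : 0 ≤ 1 - x := by linarith [hx.2]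
    simp only [Complex.ofReal_mul, Complex.ofReal_cpow h1, Complex.ofReal_cpow h2]
    push_cast; rfl
  have hI2 : IntegrableOn (fun v : ℝ => v ^ (a-1) * (1-v) ^ (b-1)) (Ioo 0 1) := by
    have := hI.re
    simpa [IntegrableOn] using! this
  refine ⟨hI2, ?_⟩
  have h3 := ProbabilityTheory.beta_eq_betaIntegralReal a b ha hb
  rw [ProbabilityTheory.beta] at h3
  rw [h3, Complex.betaIntegral, intervalIntegral.integral_of_le zero_le_one,
    integral_Ioc_eq_integral_Ioo]
  rw [← Complex.ofReal_re (∫ v in Ioo (0:ℝ) 1, v ^ (a-1) * (1-v) ^ (b-1)), ← integral_complex_ofReal]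
  congr 1
  refine setIntegral_congr_fun measurableSet_Ioo ?_
  intro x hx
  have h1 : 0 ≤ x := hx.1.le
  have h2 : 0 ≤ 1 - x := by linarith [hx.2]
  simp only [Complex.ofReal_mul, Complex.ofReal_cpow h1, Complex.ofReal_cpow h2]
  push_cast; rfl

open MeasureTheory Set in
lemma beta_sq (a b : ℝ) (ha : 0 < a) (hb : 0 < b) :
    IntegrableOn (fun u : ℝ => u ^ (2*a-1) * (1-u^2) ^ (b-1)) (Ioo 0 1) ∧
    ∫ u in Ioo (0:ℝ) 1, u ^ (2*a-1) * (1-u^2) ^ (b-1)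
      = Real.Gamma a * Real.Gamma b / Real.Gamma (a+b) / 2 := by
  have him : (fun u : ℝ => u^2) '' Ioo 0 1 = Ioo 0 1 := by
    ext y; constructor
    · rintro ⟨x, hx, rfl⟩
      exact ⟨by have := hx.1; positivity, by nlinarith [hx.1, hx.2]⟩
    · intro hy
      refine ⟨√y, ⟨Real.sqrt_pos.2 hy.1, ?_⟩, Real.sq_sqrt hy.1.le⟩
      rw [Real.sqrt_lt' one_pos]; linarith [hy.2]
  have hinj : InjOn (fun u : ℝ => u^2) (Ioo 0 1) := by
    intro x hx y hy h
    exact (sq_eq_sq₀ hx.1.le hy.1.le).1 h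
  have hd : ∀ x ∈ Ioo (0:ℝ) 1, HasDerivWithinAt (fun u : ℝ => u^2) (2*x) (Ioo 0 1) x := by
    intro x _
    simpa using (hasDerivAt_pow 2 x).hasDerivWithinAt
  have e : ∀ x ∈ Ioo (0:ℝ) 1, |2*x| • ((x^2) ^ (a-1) * (1-x^2)^(b-1))
      = 2 * (x ^ (2*a-1) * (1-x^2) ^ (b-1)) := by
    intro x hx
    rw [abs_of_pos (by linarith [hx.1]), smul_eq_mul, ← Real.rpow_natCast x 2, ← Real.rpow_mul hx.1.le]
    have : x ^ (2*a-1) = x * x ^ (((2:ℕ):ℝ) * (a-1)) := by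
      rw [show 2*a-1 = 1 + ((2:ℕ):ℝ) * (a-1) by push_cast; ring, Real.rpow_add hx.1, Real.rpow_one]
    rw [this]; ring
  obtain ⟨h1, h2⟩ := beta_real a b ha hb
  have i1 := integrableOn_image_iff_integrableOn_abs_deriv_smul measurableSet_Ioo hd hinj
    (fun v : ℝ => v ^ (a-1) * (1-v) ^ (b-1))
  have i2 := integral_image_eq_integral_abs_deriv_smul measurableSet_Ioo hd hinj
    (fun v : ℝ => v ^ (a-1) * (1-v) ^ (b-1))
  rw [him] at i1 i2
  have i3 := (i1.1 h1).congr_fun e measurableSet_Ioo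
  rw [setIntegral_congr_fun measurableSet_Ioo e, h2, integral_const_mul] at i2
  refine ⟨?_, by linarith⟩
  have := Integrable.const_mul i3 (1/2)
  simpa [IntegrableOn] using! this

open MeasureTheory Set in
lemma powR (s : ℝ) (hs : 0 < s) :
    IntegrableOn (fun u : ℝ => (u * (1-u^2)) ^ (s-1)) (Ioo 0 1) ∧
    ∫ u in Ioo (0:ℝ) 1, (u * (1-u^2)) ^ (s-1)
      = Real.Gamma (s/2) * Real.Gamma s / Real.Gamma (3*s/2) / 2 := by
  obtain ⟨h1, h2⟩ := beta_sq (s/2) s (by positivity) hs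
  have e : ∀ u ∈ Ioo (0:ℝ) 1, u ^ (2*(s/2)-1) * (1-u^2) ^ (s-1) = (u * (1-u^2)) ^ (s-1) := by
    intro u hu
    rw [Real.mul_rpow hu.1.le (by nlinarith [hu.1, hu.2])]
    congr 2; ring
  refine ⟨h1.congr_fun e measurableSet_Ioo, ?_⟩
  rw [← setIntegral_congr_fun measurableSet_Ioo e, h2]
  congr 3; ring

open MeasureTheory Set in
lemma derivR :
    IntegrableOn (fun u : ℝ => Real.log (u * (1-u^2)) / √(u * (1-u^2))) (Ioo 0 1) ∧
    HasDerivAt (fun s : ℝ => ∫ u in Ioo (0:ℝ) 1, (u * (1-u^2)) ^ (s-1))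
      (∫ u in Ioo (0:ℝ) 1, Real.log (u * (1-u^2)) / √(u * (1-u^2))) (1/2) := by
  have key := hasDerivAt_integral_of_dominated_loc_of_deriv_le
    (μ := volume.restrict (Ioo (0:ℝ) 1))
    (F := fun (s u : ℝ) => (u * (1-u^2)) ^ (s-1))
    (F' := fun (s u : ℝ) => (u * (1-u^2)) ^ (s-1) * Real.log (u * (1-u^2)))
    (x₀ := 1/2) (s := Ioi (1/4)) (bound := fun u => 8 * (u * (1-u^2)) ^ ((1/8:ℝ)-1))
    (Ioi_mem_nhds (by norm_num)) (Filter.Eventually.of_forall fun s => (Measurable.pow_const (by fun_prop) _).aestronglyMeasurable)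
    (powR (1/2) (by norm_num)).1
    ((Measurable.pow_const (by fun_prop) _).mul (by fun_prop)).aestronglyMeasurable ?_
    (Integrable.const_mul (powR (1/8) (by norm_num)).1 8) ?_
  · have e : ∀ u ∈ Ioo (0:ℝ) 1, (u * (1-u^2)) ^ ((1/2:ℝ)-1) * Real.log (u * (1-u^2))
        = Real.log (u * (1-u^2)) / √(u * (1-u^2)) := by
      intro u hu
      have hw : 0 < u * (1-u^2) := mul_pos hu.1 (by nlinarith [hu.1, hu.2])
      rw [show (1/2:ℝ)-1 = -(1/2) by norm_num, Real.rpow_neg hw.le, ← Real.sqrt_eq_rpow]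
      field_simp
    rw [setIntegral_congr_fun measurableSet_Ioo e] at key
    exact ⟨IntegrableOn.congr_fun key.1 e measurableSet_Ioo, key.2⟩
  · filter_upwards [ae_restrict_mem measurableSet_Ioo] with u hu s hs
    have hw : 0 < u * (1-u^2) := mul_pos hu.1 (by nlinarith [hu.1, hu.2])
    have hw1 : u * (1-u^2) ≤ 1 := by nlinarith [hu.1, hu.2, sq_nonneg u]
    set w := u * (1-u^2)
    have h := (Real.abs_log_mul_self_rpow_lt w (1/8) hw hw1 (by norm_num)).le
    have h2 : w ^ (s-1) ≤ w ^ ((1/8:ℝ)-1) * w ^ (1/8:ℝ) := by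
      rw [← Real.rpow_add hw]
      apply Real.rpow_le_rpow_of_exponent_ge hw hw1
      have : (1/4:ℝ) < s := hs
      linarith
    have p1 := Real.rpow_pos_of_pos hw ((1/8:ℝ)-1)
    have p2 := Real.rpow_pos_of_pos hw ((1/8:ℝ))
    rw [norm_mul, Real.norm_eq_abs, Real.norm_eq_abs, abs_of_pos (Real.rpow_pos_of_pos hw _)]
    rw [abs_mul, abs_of_pos p2] at h
    calc w ^ (s-1) * |Real.log w| ≤ (w ^ ((1/8:ℝ)-1) * w ^ (1/8:ℝ)) * |Real.log w| := by gcongr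
      _ = w ^ ((1/8:ℝ)-1) * (|Real.log w| * w ^ (1/8:ℝ)) := by ring
      _ ≤ w ^ ((1/8:ℝ)-1) * (1 / (1/8)) := by gcongr
      _ = _ := by ring
  · filter_upwards [ae_restrict_mem measurableSet_Ioo] with u hu s hs
    have hw : 0 < u * (1-u^2) := mul_pos hu.1 (by nlinarith [hu.1, hu.2])
    have := ((hasDerivAt_id s).sub_const 1).const_rpow hw
    convert! this using 1
    simp; ring

lemma gammaDeriv {d : ℝ}
    (h : HasDerivAt (fun s : ℝ => Real.Gamma (s/2) * Real.Gamma s / Real.Gamma (3*s/2) / 2) d (1/2)) :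
    d = Real.Gamma (1/4) ^ 2 / √(2*π) / 2 * (Real.log 2 - π) := by
  have hG : ∀ x : ℝ, 0 < x → HasDerivAt Real.Gamma (deriv Real.Gamma x) x := by
    intro x hx
    refine (Real.differentiableAt_Gamma fun m => ?_).hasDerivAt
    have : (0:ℝ) ≤ m := m.cast_nonneg
    linarith
  have ha := hG (1/4) (by norm_num)
  have hb := hG (3/4) (by norm_num)
  have hc := hG (1/2) (by norm_num)
  have pa := Real.Gamma_pos_of_pos (show (0:ℝ) < 1/4 by norm_num)
  have pb := Real.Gamma_pos_of_pos (show (0:ℝ) < 3/4 by norm_num)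
  have ec := Real.Gamma_one_half_eq
  -- reflection
  have er := Real.Gamma_mul_Gamma_one_sub (1/4)
  have hs4 : Real.sin (π * (1/4)) = √2/2 := by rw [← Real.sin_pi_div_four]; ring_nf
  have hc4 : Real.cos (π * (1/4)) = √2/2 := by rw [← Real.cos_pi_div_four]; ring_nf
  have dr : HasDerivAt (fun s : ℝ => Real.Gamma s * Real.Gamma (1-s))
      (deriv Real.Gamma (1/4) * Real.Gamma (3/4) - Real.Gamma (1/4) * deriv Real.Gamma (3/4)) (1/4) := by
    have hb' : HasDerivAt Real.Gamma (deriv Real.Gamma (3/4)) (1 - 1/4) := by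
      convert! hb using 1; norm_num
    have := ha.mul (hb'.comp (1/4:ℝ) ((hasDerivAt_id (1/4:ℝ)).const_sub 1))
    convert! this using 1
    simp only [Function.comp]; norm_num; ring
  have dr2 : HasDerivAt (fun s : ℝ => Real.Gamma s * Real.Gamma (1-s))
      (-(π * (√2/2 * π)) / (√2/2)^2) (1/4) := by
    rw [funext Real.Gamma_mul_Gamma_one_sub]
    have h1 : HasDerivAt (fun s : ℝ => Real.sin (π * s)) (√2/2 * π) (1/4) := by
      have := ((hasDerivAt_id (1/4:ℝ)).const_mul π).sin
      simpa only [id, hc4, mul_one] using this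
    have := (hasDerivAt_const (1/4:ℝ) π).div h1 (by rw [hs4]; positivity)
    convert! this using 1
    rw [hs4]; ring
  have E1 := dr.unique dr2
  -- duplication
  have dd : HasDerivAt (fun s : ℝ => Real.Gamma s * Real.Gamma (s+1/2))
      (deriv Real.Gamma (1/4) * Real.Gamma (3/4) + Real.Gamma (1/4) * deriv Real.Gamma (3/4)) (1/4) := by
    have hb' : HasDerivAt Real.Gamma (deriv Real.Gamma (3/4)) (1/4 + 1/2) := by
      convert! hb using 1; norm_num
    have := ha.mul (hb'.comp (1/4:ℝ) ((hasDerivAt_id (1/4:ℝ)).add_const (1/2)))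
    convert! this using 1
    simp only [Function.comp, id]; norm_num
  have e2 : (2:ℝ) ^ (1 - 2 * (1/4:ℝ)) = √2 := by rw [Real.sqrt_eq_rpow]; norm_num
  have dd2 : HasDerivAt (fun s : ℝ => Real.Gamma s * Real.Gamma (s+1/2))
      ((2 * deriv Real.Gamma (1/2) * √2 - 2 * √π * (Real.log 2 * √2)) * √π) (1/4) := by
    rw [funext Real.Gamma_mul_Gamma_add_half]
    have hc' : HasDerivAt Real.Gamma (deriv Real.Gamma (1/2)) (2 * (1/4)) := by
      convert! hc using 1; norm_num
    have h2 := (((hasDerivAt_id (1/4:ℝ)).const_mul 2).const_sub 1).const_rpow (a := 2) (by norm_num)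
    have := ((hc'.comp (1/4:ℝ) ((hasDerivAt_id (1/4:ℝ)).const_mul 2)).mul h2).mul_const (√π)
    convert! this using 1
    simp only [Function.comp, id, e2, mul_one]
    rw [show (2:ℝ) * (1/4) = 1/2 by norm_num, ec]; ring
  have E2 := dd.unique dd2
  have dh : HasDerivAt (fun s : ℝ => Real.Gamma (s/2) * Real.Gamma s / Real.Gamma (3*s/2) / 2)
      (((deriv Real.Gamma (1/4) / 2 * √π + Real.Gamma (1/4) * deriv Real.Gamma (1/2)) * Real.Gamma (3/4)
        - Real.Gamma (1/4) * √π * (deriv Real.Gamma (3/4) * (3/2))) / Real.Gamma (3/4) ^ 2 / 2) (1/2) := by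
    have ha' : HasDerivAt Real.Gamma (deriv Real.Gamma (1/4)) ((1/2)/2) := by
      convert! ha using 1; norm_num
    have hb' : HasDerivAt Real.Gamma (deriv Real.Gamma (3/4)) (3*(1/2)/2) := by
      convert! hb using 1; norm_num
    have := (((ha'.comp (1/2:ℝ) ((hasDerivAt_id (1/2:ℝ)).div_const 2)).mul hc).div
      (hb'.comp (1/2:ℝ) (((hasDerivAt_id (1/2:ℝ)).const_mul 3).div_const 2))
      (by simp only [Function.comp, id]; norm_num; exact pb.ne')).div_const 2
    convert! this using 1
    simp only [Function.comp, id, Pi.mul_apply]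
    rw [show (1:ℝ)/2/2 = 1/4 by norm_num, show (3:ℝ)*(1/2)/2 = 3/4 by norm_num, ec]; ring
  rw [h.unique dh]
  rw [show (1:ℝ)-1/4 = 3/4 by norm_num, hs4] at er
  rw [Real.sqrt_mul (by norm_num)]
  set a := Real.Gamma (1/4)
  set b := Real.Gamma (3/4)
  set a' := deriv Real.Gamma (1/4)
  set b' := deriv Real.Gamma (3/4)
  set c' := deriv Real.Gamma (1/2)
  have q2 : √2^2 = 2 := Real.sq_sqrt (by norm_num)
  have qp : √π^2 = π := Real.sq_sqrt Real.pi_pos.le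
  have p2 : 0 < √2 := by positivity
  have pp : 0 < √π := by positivity
  generalize √2 = r at *
  generalize √π = p at *
  have E3 : a * b = r * p^2 := by
    rw [er, qp]; field_simp; linear_combination -q2
  have E1' : a' * b - a * b' = -π^2 * r := by
    rw [E1]; field_simp; linear_combination q2
  have N : (a'/2 * p + a * c') * b - a * p * (b' * (3/2)) = r * p^3 * (Real.log 2 - π) := by
    have c1 : r * p * c' = (a' * b + a * b')/2 + r * p^2 * Real.log 2 := by linear_combination -E2/2
    linear_combination c' * E3 + p * c1 + p * E1' + r * p * π * qp
  rw [N]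
  field_simp
  linear_combination -(Real.log 2 - π) * (a * b + r * p^2) * E3

open MeasureTheory Set in
lemma intLogW : ∫ u in Ioo (0:ℝ) 1, Real.log (u * (1-u^2)) / √(u * (1-u^2))
    = Real.Gamma (1/4) ^ 2 / √(2*π) / 2 * (Real.log 2 - π) := by
  apply gammaDeriv
  refine derivR.2.congr_of_eventuallyEq ?_
  filter_upwards [Ioi_mem_nhds (show (0:ℝ) < 1/2 by norm_num)] with s hs
  exact (powR s hs).2.symm

open MeasureTheory Set in
lemma intLogU : IntegrableOn (fun u : ℝ => Real.log u / √(u * (1-u^2))) (Ioo 0 1) := by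
  refine Integrable.mono derivR.1 (Measurable.aestronglyMeasurable (by fun_prop)) ?_
  filter_upwards [ae_restrict_mem measurableSet_Ioo] with u hu
  have h1 : 0 < 1 - u^2 := by nlinarith [hu.1, hu.2]
  have h2 : 1 - u^2 ≤ 1 := by nlinarith [sq_nonneg u]
  rw [norm_div, norm_div]
  gcongr
  rw [Real.log_mul hu.1.ne' h1.ne', Real.norm_eq_abs, Real.norm_eq_abs,
    abs_of_nonpos (Real.log_nonpos hu.1.le hu.2.le), abs_of_nonpos]
  · linarith [Real.log_nonpos h1.le h2]
  · linarith [Real.log_nonpos h1.le h2, Real.log_nonpos hu.1.le hu.2.le]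

open MeasureTheory Set in
lemma intLogS : IntegrableOn (fun u : ℝ => Real.log ((1-u)/(1+u)) / √(u * (1-u^2))) (Ioo 0 1) ∧
    ∫ u in Ioo (0:ℝ) 1, Real.log ((1-u)/(1+u)) / √(u * (1-u^2))
      = ∫ u in Ioo (0:ℝ) 1, Real.log u / √(u * (1-u^2)) := by
  have hm : ∀ x ∈ Ioo (0:ℝ) 1, (1-x)/(1+x) ∈ Ioo (0:ℝ) 1 := by
    intro x hx
    have := hx.1; have := hx.2
    exact ⟨div_pos (by linarith) (by linarith), by rw [div_lt_one (by linarith)]; linarith⟩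
  have hv : ∀ x ∈ Ioo (0:ℝ) 1, (1-(1-x)/(1+x))/(1+(1-x)/(1+x)) = x := by
    intro x hx
    have : 1 + x ≠ 0 := by linarith [hx.1]
    field_simp; ring
  have him : (fun u : ℝ => (1-u)/(1+u)) '' Ioo 0 1 = Ioo 0 1 := by
    ext y; constructor
    · rintro ⟨x, hx, rfl⟩
      exact hm x hx
    · intro hy
      exact ⟨_, hm y hy, hv y hy⟩
  have hinj : InjOn (fun u : ℝ => (1-u)/(1+u)) (Ioo 0 1) := by
    intro x hx y hy h
    simp only at h
    rw [← hv x hx, ← hv y hy, h]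
  have hd : ∀ x ∈ Ioo (0:ℝ) 1,
      HasDerivWithinAt (fun u : ℝ => (1-u)/(1+u)) (-2/(1+x)^2) (Ioo 0 1) x := by
    intro x hx
    have h := ((hasDerivAt_id x).const_sub 1).div ((hasDerivAt_id x).const_add 1)
      (by simp; linarith [hx.1])
    convert! h.hasDerivWithinAt using 1
    simp; ring
  have e : ∀ x ∈ Ioo (0:ℝ) 1, |-2/(1+x)^2| • (Real.log ((1-x)/(1+x)) /
      √((1-x)/(1+x) * (1-((1-x)/(1+x))^2))) = Real.log ((1-x)/(1+x)) / √(x * (1-x^2)) := by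
    intro x hx
    have h0 := hx.1
    have h1 : 0 < 1 - x^2 := by nlinarith [hx.1, hx.2]
    have hp : 0 < 1 + x := by linarith
    have : (1-x)/(1+x) * (1-((1-x)/(1+x))^2) = (2/(1+x)^2)^2 * (x * (1-x^2)) := by
      field_simp; ring
    rw [this, Real.sqrt_mul (by positivity), Real.sqrt_sq (by positivity), smul_eq_mul,
      neg_div, abs_neg, abs_of_pos (by positivity)]
    have : 0 < √(x * (1-x^2)) := by positivity
    field_simp
  have i1 := integrableOn_image_iff_integrableOn_abs_deriv_smul measurableSet_Ioo hd hinj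
    (fun u : ℝ => Real.log u / √(u * (1-u^2)))
  have i2 := integral_image_eq_integral_abs_deriv_smul measurableSet_Ioo hd hinj
    (fun u : ℝ => Real.log u / √(u * (1-u^2)))
  rw [him] at i1 i2
  rw [setIntegral_congr_fun measurableSet_Ioo e] at i2
  exact ⟨(i1.1 intLogU).congr_fun e measurableSet_Ioo, i2.symm⟩

open MeasureTheory Set in
lemma intK : IntegrableOn (fun u : ℝ => Real.log (1-u) / √(u * (1-u^2))) (Ioo 0 1) ∧
    ∫ u in Ioo (0:ℝ) 1, Real.log (1-u) / √(u * (1-u^2))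
      = Real.Gamma (1/4) ^ 2 / √(2*π) / 4 * (Real.log 2 - π) := by
  have e : ∀ u ∈ Ioo (0:ℝ) 1, (1/2) * (Real.log (u * (1-u^2)) / √(u * (1-u^2))
      - Real.log u / √(u * (1-u^2)) + Real.log ((1-u)/(1+u)) / √(u * (1-u^2)))
      = Real.log (1-u) / √(u * (1-u^2)) := by
    intro u hu
    have h0 := hu.1
    have h1 : 0 < 1 - u := by linarith [hu.2]
    have h2 : 0 < 1 + u := by linarith
    rw [show 1 - u^2 = (1-u)*(1+u) by ring, Real.log_mul h0.ne' (by positivity),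
      Real.log_mul h1.ne' h2.ne', Real.log_div h1.ne' h2.ne']
    ring
  have i := ((derivR.1.sub intLogU).add intLogS.1).const_mul (1/2)
  refine ⟨IntegrableOn.congr_fun i e measurableSet_Ioo, ?_⟩
  rw [← setIntegral_congr_fun measurableSet_Ioo e, integral_const_mul,
    integral_add (f := fun u : ℝ => Real.log (u * (1-u^2)) / √(u * (1-u^2))
      - Real.log u / √(u * (1-u^2))) (derivR.1.sub intLogU) intLogS.1, integral_sub derivR.1 intLogU, intLogS.2, intLogW]
  ring

open MeasureTheory Set in
lemma intM : IntegrableOn (fun u : ℝ => u / √(u * (1-u^2))) (Ioo 0 1) ∧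
    ∫ u in Ioo (0:ℝ) 1, u / √(u * (1-u^2))
      = 2 * √2 * π ^ ((3:ℝ)/2) / Real.Gamma (1/4) ^ 2 := by
  obtain ⟨h1, h2⟩ := beta_sq (3/4) (1/2) (by norm_num) (by norm_num)
  have e : ∀ u ∈ Ioo (0:ℝ) 1, u ^ (2*(3/4:ℝ)-1) * (1-u^2) ^ ((1/2:ℝ)-1) = u / √(u * (1-u^2)) := by
    intro u hu
    have h0 := hu.1
    have h1 : 0 < 1 - u^2 := by nlinarith [hu.1, hu.2]
    rw [show 2*(3/4:ℝ)-1 = 1/2 by norm_num, show (1/2:ℝ)-1 = -(1/2) by norm_num,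
      Real.rpow_neg h1.le, ← Real.sqrt_eq_rpow, ← Real.sqrt_eq_rpow, Real.sqrt_mul h0.le]
    have := Real.sqrt_pos.2 h0
    have := Real.sqrt_pos.2 h1
    field_simp
    exact Real.sq_sqrt h0.le
  refine ⟨h1.congr_fun e measurableSet_Ioo, ?_⟩
  rw [← setIntegral_congr_fun measurableSet_Ioo e, h2]
  have er := Real.Gamma_mul_Gamma_one_sub (1/4)
  have hs4 : Real.sin (π * (1/4)) = √2/2 := by rw [← Real.sin_pi_div_four]; ring_nf
  rw [show (1:ℝ)-1/4 = 3/4 by norm_num, hs4] at er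
  have pa := Real.Gamma_pos_of_pos (show (0:ℝ) < 1/4 by norm_num)
  rw [show (3/4:ℝ)+1/2 = 1/4+1 by norm_num, Real.Gamma_add_one (by norm_num), Real.Gamma_one_half_eq]
  have hp : π ^ ((3:ℝ)/2) = π * √π := by
    rw [Real.sqrt_eq_rpow, show (3:ℝ)/2 = 1 + 1/2 by norm_num, Real.rpow_add Real.pi_pos, Real.rpow_one]
  have q2 : √2^2 = 2 := Real.sq_sqrt (by norm_num)
  have p2 : 0 < √2 := by positivity
  rw [hp]
  have E3 : Real.Gamma (1/4) * Real.Gamma (3/4) = √2 * π := by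
    rw [er]; field_simp; linear_combination -q2
  field_simp
  linear_combination 4 * E3

open MeasureTheory Set in
lemma intQ : ∫ u in Ioo (0:ℝ) 1, u * (3+u) / (1+u) * Real.log (1-u) / √(u * (1-u^2))
    = Real.Gamma (1/4) ^ 2 / √(2*π) / 4 * (Real.log 2 - π)
      - 2 * (2 * √2 * π ^ ((3:ℝ)/2) / Real.Gamma (1/4) ^ 2) := by
  set D' : ℝ → ℝ := fun u => (1-2*u-u^2)/(2*(1+u)) * (Real.log (1-u) / √(u * (1-u^2)))
    - u / √(u * (1-u^2)) with hD'
  have iD : IntegrableOn D' (Ioo 0 1) := by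
    refine Integrable.sub ?_ intM.1
    refine Integrable.mono intK.1 (Measurable.aestronglyMeasurable (by fun_prop)) ?_
    filter_upwards [ae_restrict_mem measurableSet_Ioo] with u hu
    rw [norm_mul]
    refine mul_le_of_le_one_left (norm_nonneg _) ?_
    have h0 := hu.1
    have h1 := hu.2
    rw [Real.norm_eq_abs, abs_le]
    constructor
    · rw [le_div_iff₀ (by linarith)]; nlinarith
    · rw [div_le_iff₀ (by linarith)]; nlinarith
  have zD : ∫ u in Ioo (0:ℝ) 1, D' u = 0 := by
    have := intervalIntegral.integral_eq_sub_of_hasDerivAt_of_le (a := 0) (b := 1) zero_le_one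
      (f := fun u : ℝ => √(u * (1+u)) / (1+u) * (2 * (√(1-u) * Real.log (√(1-u))))) (f' := D') ?_ ?_
      ((intervalIntegrable_iff_integrableOn_Ioo_of_le zero_le_one).2 iD)
    · rw [intervalIntegral.integral_of_le zero_le_one, integral_Ioc_eq_integral_Ioo] at this
      simpa using this
    · refine ContinuousOn.mul ?_ (Continuous.continuousOn ?_)
      · refine ContinuousOn.div (by fun_prop) (by fun_prop) ?_
        intro x hx
        linarith [hx.1]
      · exact continuous_const.mul (Real.continuous_mul_log.comp (by fun_prop))
    · intro u hu
      have h0 := hu.1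
      have h1 : 0 < 1 - u := by linarith [hu.2]
      have h2 : 0 < 1 + u := by linarith
      have hw : 0 < u * (1 - u^2) := by
        rw [show 1 - u^2 = (1-u)*(1+u) by ring]; positivity
      have hder : HasDerivAt (fun u : ℝ => √(u * (1-u^2)) / (1+u) * Real.log (1-u)) (D' u) u := by
        have a1 : HasDerivAt (fun u : ℝ => u * (1-u^2)) (1 - 3*u^2) u := by
          have := (hasDerivAt_id u).mul ((hasDerivAt_pow 2 u).const_sub 1)
          convert! this using 1
          simp; ring
        have a2 := a1.sqrt hw.ne'
        have a3 := (hasDerivAt_id u).const_add 1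
        have a4 := ((hasDerivAt_id u).const_sub 1).log h1.ne'
        have a5 := (a2.div a3 h2.ne').mul a4
        convert! a5 using 1
        simp only [hD', id, Pi.div_apply]
        have hR := Real.sqrt_pos.2 hw
        have hq := Real.sq_sqrt hw.le
        have e1 : √(u * (1-u^2)) / (1+u) * (-1/(1-u)) = - (u / √(u * (1-u^2))) := by
          field_simp
          rw [hq]; ring
        rw [e1, show Real.sqrt (u * (1-u^2)) * 1 = u * (1-u^2) / √(u * (1-u^2)) by
          field_simp; exact hq]
        field_simp
        ring
      refine hder.congr_of_eventuallyEq ?_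
      filter_upwards [Ioo_mem_nhds hu.1 hu.2] with v hv
      have k1 : 0 < 1 - v := by linarith [hv.2]
      have k2 : 0 < v := hv.1
      rw [Real.log_sqrt k1.le, show v * (1-v^2) = (v * (1+v)) * (1-v) by ring,
        Real.sqrt_mul (show 0 ≤ v * (1+v) by positivity)]
      ring
  have e : ∀ u ∈ Ioo (0:ℝ) 1, Real.log (1-u) / √(u * (1-u^2)) - 2 * D' u
      - 2 * (u / √(u * (1-u^2))) = u * (3+u) / (1+u) * Real.log (1-u) / √(u * (1-u^2)) := by
    intro u hu
    have h2 : 1 + u ≠ 0 := by linarith [hu.1]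
    simp only [hD']
    field_simp
    ring
  rw [← setIntegral_congr_fun measurableSet_Ioo e,
    integral_sub (f := fun u : ℝ => Real.log (1-u) / √(u * (1-u^2)) - 2 * D' u)
      (intK.1.sub (iD.const_mul 2)) (intM.1.const_mul 2),
    integral_sub intK.1 (iD.const_mul 2), integral_const_mul, integral_const_mul, zD, intK.2, intM.2]
  ring

theorem stmt19 :
    ∫ x in (0 : ℝ)..1, Real.sqrt (1 - x ^ 2) * (x ^ 2 - 4) * Real.log x / (2 - x ^ 2) ^ ((3 : ℝ) / 2)
      = Real.sqrt 2 * π ^ ((3 : ℝ) / 2) / Real.Gamma (1 / 4) ^ 2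
        + (Real.sqrt (π / 2) / 16 - Real.log 2 / (16 * Real.sqrt (2 * π))) * Real.Gamma (1 / 4) ^ 2 := by
  have him : (fun x : ℝ => 1-x^2) '' Set.Ioo 0 1 = Set.Ioo 0 1 := by
    ext y; constructor
    · rintro ⟨x, hx, rfl⟩
      have := hx.1; have := hx.2
      constructor <;> simp only <;> nlinarith
    · intro hy
      have h1 : 0 < 1 - y := by linarith [hy.2]
      refine ⟨√(1-y), ⟨Real.sqrt_pos.2 h1, ?_⟩, ?_⟩
      · rw [Real.sqrt_lt' one_pos]; linarith [hy.1]
      · simp only [Real.sq_sqrt h1.le]; ring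
  have hinj : Set.InjOn (fun x : ℝ => 1-x^2) (Set.Ioo 0 1) := by
    intro x hx y hy h
    simp only at h
    exact (sq_eq_sq₀ hx.1.le hy.1.le).1 (by linarith)
  have hd : ∀ x ∈ Set.Ioo (0:ℝ) 1,
      HasDerivWithinAt (fun x : ℝ => 1-x^2) (-(2*x)) (Set.Ioo 0 1) x := by
    intro x _
    simpa using ((hasDerivAt_pow 2 x).const_sub 1).hasDerivWithinAt
  have e : ∀ x ∈ Set.Ioo (0:ℝ) 1, |-(2*x)| • ((1-x^2) * (3+(1-x^2)) / (1+(1-x^2))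
      * Real.log (1-(1-x^2)) / √((1-x^2) * (1-(1-x^2)^2)))
      = (-4) * (Real.sqrt (1 - x ^ 2) * (x ^ 2 - 4) * Real.log x / (2 - x ^ 2) ^ ((3 : ℝ) / 2)) := by
    intro x hx
    have h0 := hx.1
    have h1 : 0 < 1 - x^2 := by nlinarith [hx.1, hx.2]
    have h2 : 0 < 2 - x^2 := by linarith
    rw [abs_neg, abs_of_pos (by linarith), smul_eq_mul,
      show (1-x^2) * (1-(1-x^2)^2) = x^2 * ((1-x^2) * (2-x^2)) by ring,
      Real.sqrt_mul (by positivity), Real.sqrt_sq h0.le, Real.sqrt_mul h1.le,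
      show 1 - (1-x^2) = x^2 by ring, Real.log_pow, show (3:ℝ)/2 = 1 + 1/2 by norm_num,
      Real.rpow_add h2, Real.rpow_one, ← Real.sqrt_eq_rpow, show 1 + (1-x^2) = 2 - x^2 by ring]
    have s1 := Real.sqrt_pos.2 h1
    have s2 := Real.sqrt_pos.2 h2
    have q1 := Real.sq_sqrt h1.le
    field_simp
    rw [q1]
    push_cast
    ring
  have i2 := MeasureTheory.integral_image_eq_integral_abs_deriv_smul measurableSet_Ioo hd hinj
    (fun u : ℝ => u * (3+u) / (1+u) * Real.log (1-u) / √(u * (1-u^2)))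
  rw [him, intQ, MeasureTheory.setIntegral_congr_fun measurableSet_Ioo e,
    MeasureTheory.integral_const_mul] at i2
  rw [intervalIntegral.integral_of_le zero_le_one, MeasureTheory.integral_Ioc_eq_integral_Ioo]
  have hs : √(π/2) = π / √(2*π) := by
    have := Real.pi_pos
    rw [eq_div_iff (by positivity), ← Real.sqrt_mul (by positivity),
      show π/2*(2*π) = π^2 by ring, Real.sqrt_sq (by positivity)]
  rw [hs]
  have : 0 < √(2*π) := by have := Real.pi_pos; positivity
  linear_combination (norm := skip) (1/4) * i2
  field_simp
  ring
end
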